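/- There exist universal constants C > 0 and K > 0 such that if n ≥ C·(s⋆·log(max(n,p)))² and p ≥ 3, then with probability at least 1 − 5·exp(−n/24) − 3/p, simultaneously for every S ∈ 𝒮_{s⋆}: the matrix V_{n,S} is positive definite and ‖V_{n,S}^{−1/2}·∑_{i=1}^n (Y_i − exp(X_iᵀθ₀))·X_{i,S}‖₂ ≤ K·√(|S|·log p). -/

import Mathlib

open MeasureTheory ProbabilityTheory Matrix Real

/-- The law of an `n × p` matrix with i.i.d. standard normal entries. -/
noncomputable def gaussMat (n p : ℕ) : Measure (Fin n → Fin p → ℝ) :=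
  Measure.pi fun _ : Fin n => Measure.pi fun _ : Fin p => gaussianReal 0 1

instance (n p : ℕ) : IsProbabilityMeasure (gaussMat n p) := by
  unfold gaussMat; infer_instance

/-- Weighted Gram matrix `∑ᵢ wᵢ · X_{i,S} X_{i,S}ᵀ`. -/
noncomputable def gramW {n p : ℕ} (S : Finset (Fin p)) (w : Fin n → ℝ)
    (x : Fin n → Fin p → ℝ) : Matrix S S ℝ :=
  Matrix.of fun j k => ∑ i, w i * x i j.1 * x i k.1

/-- Chernoff bound for a sum of independent variables on a product space. -/
lemma measureReal_pi_sum_ge_le {ι E : Type*} [Fintype ι] [MeasurableSpace E]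
    (μ : ι → Measure E) [∀ i, IsProbabilityMeasure (μ i)] (f : ι → E → ℝ) (r : ι → ℝ) (τ : ℝ)
    (hint : ∀ i, Integrable (fun x => exp (f i x)) (μ i))
    (hle : ∀ i, ∫ x, exp (f i x) ∂μ i ≤ exp (r i)) :
    (Measure.pi μ).real {x | τ ≤ ∑ i, f i (x i)} ≤ exp (∑ i, r i - τ) := by
  have hint' : Integrable (fun x : ι → E => exp (1 * ∑ i, f i (x i))) (Measure.pi μ) := by
    simpa only [one_mul, exp_sum] using Integrable.fintype_prod hint
  refine (measure_ge_le_exp_mul_mgf (X := fun x : ι → E => ∑ i, f i (x i)) τ zero_le_one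
    hint').trans ?_
  rw [sub_eq_neg_add, exp_add, neg_one_mul]
  refine mul_le_mul_of_nonneg_left ?_ (exp_pos _).le
  simp only [mgf, one_mul, exp_sum]
  rw [integral_fintype_prod_eq_prod (μ := μ) fun i x => exp (f i x)]
  exact Finset.prod_le_prod (fun i _ => integral_nonneg fun x => (exp_pos _).le) fun i _ => hle i

/-- A unit linear combination of i.i.d. standard normal variables is standard normal. -/
lemma map_dotProduct_pi_gaussianReal {ι : Type*} [Fintype ι] (v : ι → ℝ) (hv : ∑ j, v j ^ 2 = 1) :
    (Measure.pi fun _ : ι => gaussianReal 0 1).map (fun x => ∑ j, x j * v j) =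
      gaussianReal 0 1 := by
  have hm : Measurable fun x : ι → ℝ => ∑ j, x j * v j := by fun_prop
  have : IsProbabilityMeasure
      ((Measure.pi fun _ : ι => gaussianReal 0 1).map fun x => ∑ j, x j * v j) :=
    Measure.isProbabilityMeasure_map hm.aemeasurable
  refine Measure.ext_of_charFun (funext fun t => ?_)
  rw [charFun_apply_real, integral_map hm.aemeasurable (by fun_prop)]
  have h1 : ∀ x : ι → ℝ, Complex.exp (t * ((∑ j, x j * v j : ℝ) : ℂ) * Complex.I) =
      ∏ j, Complex.exp (((t * v j : ℝ) : ℂ) * (x j : ℂ) * Complex.I) := by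
    intro x
    rw [← Complex.exp_sum]
    congr 1
    push_cast
    rw [Finset.mul_sum, Finset.sum_mul]
    exact Finset.sum_congr rfl fun j _ => by ring
  simp_rw [h1]
  rw [integral_fintype_prod_eq_prod (μ := fun _ : ι => gaussianReal 0 1)
    fun j (x : ℝ) => Complex.exp (((t * v j : ℝ) : ℂ) * (x : ℂ) * Complex.I)]
  simp_rw [← charFun_apply_real, charFun_gaussianReal]
  rw [← Complex.exp_sum]
  congr 1
  have h2 : (∑ j, (v j : ℂ) ^ 2) = 1 := by exact_mod_cast congrArg (fun a : ℝ => (a : ℂ)) hv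
  push_cast
  simp only [mul_zero, zero_mul, zero_sub, one_mul, mul_pow]
  rw [Finset.sum_neg_distrib, ← Finset.sum_div, ← Finset.mul_sum, h2, mul_one]

lemma gaussianPDFReal_mul_exp_mul_sq (b x : ℝ) :
    gaussianPDFReal 0 1 x • exp (-b * x ^ 2) = (√(2 * π))⁻¹ * exp (-(b + 1 / 2) * x ^ 2) := by
  simp only [gaussianPDFReal, NNReal.coe_one, mul_one, sub_zero, smul_eq_mul]
  rw [mul_assoc, ← exp_add]
  congr 2
  ring

lemma integral_exp_mul_sq_gaussianReal (b : ℝ) (hb : 0 < b + 1 / 2) :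
    ∫ x, exp (-b * x ^ 2) ∂gaussianReal 0 1 = √(1 / (1 + 2 * b)) := by
  rw [integral_gaussianReal_eq_integral_smul one_ne_zero]
  simp_rw [gaussianPDFReal_mul_exp_mul_sq]
  rw [integral_const_mul, integral_gaussian, ← sqrt_inv, ← sqrt_mul (by positivity)]
  congr 1
  have := pi_pos.ne'
  have : 1 + 2 * b ≠ 0 := by linarith
  have : 1 / 2 + b ≠ 0 := by linarith
  rw [add_comm b, inv_mul_eq_div, div_div, div_eq_div_iff (by positivity) (by positivity)]
  ring

lemma integrable_exp_mul_sq_gaussianReal (b : ℝ) (hb : 0 < b + 1 / 2) :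
    Integrable (fun x => exp (-b * x ^ 2)) (gaussianReal 0 1) := by
  rw [gaussianReal_of_var_ne_zero _ one_ne_zero,
    integrable_withDensity_iff_integrable_smul' (measurable_gaussianPDF _ _)
      (ae_of_all _ fun _ => gaussianPDF_lt_top)]
  simp_rw [toReal_gaussianPDF, gaussianPDFReal_mul_exp_mul_sq]
  exact (integrable_exp_neg_mul_sq hb).const_mul _

/-- A Gaussian design row is symmetric, so truncating the weights `exp (xᵀθ)` at `1` costs at most
half of the Laplace transform. -/
lemma integral_exp_neg_weight_mul_sq_le {ι : Type*} [Fintype ι] (θ v : ι → ℝ)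
    (hv : ∑ j, v j ^ 2 = 1) :
    ∫ x, exp (-(min 1 (exp (∑ j, x j * θ j)) * (∑ j, x j * v j) ^ 2))
      ∂(Measure.pi fun _ : ι => gaussianReal 0 1) ≤ exp (-(1 / 5)) := by
  set γ := Measure.pi fun _ : ι => gaussianReal 0 1
  set f : (ι → ℝ) → ℝ := fun x => exp (-(min 1 (exp (∑ j, x j * θ j)) * (∑ j, x j * v j) ^ 2))
  have hf1 : ∀ x, f x ≤ 1 := fun x => by
    simp only [f, exp_le_one_iff, neg_nonpos]
    positivity
  have hfm : Measurable f := by fun_prop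
  have hfi : ∀ g : (ι → ℝ) → ℝ, Measurable g → (∀ x, 0 ≤ g x) → (∀ x, g x ≤ 1) →
      Integrable g γ := fun g hg h0 h1 => Integrable.of_bound hg.aestronglyMeasurable 1
        (ae_of_all _ fun x => by rw [norm_of_nonneg (h0 x)]; exact h1 x)
  have hneg : MeasurePreserving (fun x : ι → ℝ => -x) γ γ := by
    refine measurePreserving_pi (fun _ : ι => gaussianReal 0 1) (fun _ : ι => gaussianReal 0 1)
      (f := fun _ x => -x) fun i => ⟨measurable_neg, ?_⟩
    rw [gaussianReal_map_neg, neg_zero]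
  have hsymm : ∫ x, f (-x) ∂γ = ∫ x, f x ∂γ :=
    hneg.integral_comp (MeasurableEquiv.neg (ι → ℝ)).measurableEmbedding f
  have hpt : ∀ x, f x + f (-x) ≤ 1 + exp (-(1:ℝ) * (∑ j, x j * v j) ^ 2) := by
    have key : ∀ x, 0 ≤ ∑ j, x j * θ j →
        f x + f (-x) ≤ 1 + exp (-(1:ℝ) * (∑ j, x j * v j) ^ 2) := fun x hx => by
      have : f x = exp (-(1:ℝ) * (∑ j, x j * v j) ^ 2) := by
        simp only [f]
        rw [min_eq_left (one_le_exp hx)]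
        ring_nf
      linarith [hf1 (-x)]
    intro x
    rcases le_total 0 (∑ j, x j * θ j) with hx | hx
    · exact key x hx
    · have := key (-x) (by simpa using hx)
      simp only [neg_neg, Pi.neg_apply, neg_mul, Finset.sum_neg_distrib, neg_sq] at this ⊢
      linarith
  have hG : ∫ x, exp (-(1:ℝ) * (∑ j, x j * v j) ^ 2) ∂γ = √(1 / (1 + 2 * 1)) := by
    rw [← integral_exp_mul_sq_gaussianReal 1 (by norm_num), ← map_dotProduct_pi_gaussianReal v hv,
      integral_map (Measurable.aemeasurable (by fun_prop)) (by fun_prop)]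
  have hGi : Integrable (fun x : ι → ℝ => exp (-(1:ℝ) * (∑ j, x j * v j) ^ 2)) γ :=
    hfi _ (by fun_prop) (fun x => (exp_pos _).le) fun x => by
      rw [exp_le_one_iff]; nlinarith [sq_nonneg (∑ j, x j * v j)]
  have hsum : ∫ x, (f x + f (-x)) ∂γ ≤ 1 + √(1 / (1 + 2 * 1)) := by
    refine (integral_mono ((hfi f hfm (fun x => (exp_pos _).le) hf1).add
      (hfi (fun x => f (-x)) (by fun_prop) (fun x => (exp_pos _).le) fun x => hf1 _))
      ((integrable_const 1).add hGi) hpt).trans_eq ?_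
    simp only [Pi.add_apply]
    rw [integral_add (integrable_const 1) hGi, hG]
    simp
  rw [integral_add (hfi f hfm (fun x => (exp_pos _).le) hf1)
    (hfi (fun x => f (-x)) (by fun_prop) (fun x => (exp_pos _).le) fun x => hf1 _), hsymm] at hsum
  have hsq : √(1 / (1 + 2 * 1)) ≤ 3 / 5 := by
    rw [sqrt_le_left (by norm_num)]
    norm_num
  linarith [add_one_le_exp (-(1 / 5) : ℝ)]

/-- Lower tail of the truncated weighted Gram form in a fixed direction. -/
lemma gaussMat_weighted_form_lt_le {n p : ℕ} (θ v : Fin p → ℝ) :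
    (gaussMat n p).real {x | ∑ i, min 1 (exp (∑ j, x i j * θ j)) * (∑ j, x i j * v j) ^ 2 <
      n / 10 * ∑ j, v j ^ 2} ≤ exp (-(n / 10)) := by
  rcases (Finset.sum_nonneg fun j _ => sq_nonneg (v j) : 0 ≤ ∑ j, v j ^ 2).eq_or_lt with h0 | h0
  · rw [← h0]
    have : {x : Fin n → Fin p → ℝ | ∑ i, min 1 (exp (∑ j, x i j * θ j)) *
        (∑ j, x i j * v j) ^ 2 < n / 10 * 0} = ∅ := by
      ext x
      simp only [mul_zero, Set.mem_ofPred_eq, Set.mem_empty_iff_false, iff_false, not_lt]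
      positivity
    rw [this, measureReal_empty]
    positivity
  set q := ∑ j, v j ^ 2
  set u : Fin p → ℝ := fun j => v j / √q
  have hu : ∑ j, u j ^ 2 = 1 := by
    simp only [u, div_pow, sq_sqrt h0.le]
    rw [← Finset.sum_div]
    exact div_self h0.ne'
  have hch := measureReal_pi_sum_ge_le (fun _ : Fin n => Measure.pi fun _ : Fin p => gaussianReal 0 1)
    (fun _ x => -(min 1 (exp (∑ j, x j * θ j)) * (∑ j, x j * u j) ^ 2)) (fun _ => -(1 / 5))
    (-(n / 10 : ℝ)) (fun i => Integrable.of_bound (Measurable.aestronglyMeasurable (by fun_prop)) 1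
      (ae_of_all _ fun x => by
        rw [norm_of_nonneg (exp_pos _).le, exp_le_one_iff, neg_nonpos]; positivity))
    (fun i => integral_exp_neg_weight_mul_sq_le θ u hu)
  refine (measureReal_mono ?_).trans (hch.trans_eq ?_)
  · intro x hx
    simp only [Set.mem_ofPred_eq] at hx ⊢
    have : ∀ i, (∑ j, x i j * u j) ^ 2 = (∑ j, x i j * v j) ^ 2 / q := fun i => by
      simp only [u, ← mul_div_assoc]
      rw [← Finset.sum_div, div_pow, sq_sqrt h0.le]
    simp_rw [this, ← mul_div_assoc, Finset.sum_neg_distrib, ← Finset.sum_div]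
    rw [neg_le_neg_iff, div_le_iff₀ h0]
    exact hx.le
  · congr 1
    simp
    ring

/-- Tail bound for the largest squared entry of a Gaussian design. -/
lemma gaussMat_exists_sq_gt_le {n p : ℕ} (a : ℝ) :
    (gaussMat n p).real {x | ∃ i j, a < x i j ^ 2} ≤ n * p * (2 * exp (-(a / 4))) := by
  have h1 : (gaussianReal 0 1).real {t | a < t ^ 2} ≤ 2 * exp (-(a / 4)) := by
    have hi := integrable_exp_mul_sq_gaussianReal (-(1 / 4)) (by norm_num)
    have := measure_ge_le_exp_mul_mgf (X := fun t : ℝ => t ^ 2) (t := 1 / 4) a (by norm_num)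
      (by simpa using hi)
    refine (measureReal_mono fun t (ht : a < t ^ 2) => ht.le).trans (this.trans ?_)
    have h2 : mgf (fun t : ℝ => t ^ 2) (gaussianReal 0 1) (1 / 4) ≤ 2 := by
      have := integral_exp_mul_sq_gaussianReal (-(1 / 4)) (by norm_num)
      rw [neg_neg] at this
      rw [mgf, this, sqrt_le_left (by norm_num)]
      norm_num
    calc _ ≤ exp (-(1 / 4) * a) * 2 := mul_le_mul_of_nonneg_left h2 (exp_pos _).le
      _ = _ := by rw [mul_comm]; ring_nf
  have h2 : ∀ i j, (gaussMat n p).real {x | a < x i j ^ 2} ≤ 2 * exp (-(a / 4)) := fun i j => by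
    have hmp : MeasurePreserving (fun x : Fin n → Fin p → ℝ => x i j) (gaussMat n p)
        (gaussianReal 0 1) :=
      (measurePreserving_eval (fun _ : Fin p => gaussianReal 0 1) j).comp
        (measurePreserving_eval
          (fun _ : Fin n => Measure.pi fun _ : Fin p => gaussianReal 0 1) i)
    have := hmp.measureReal_preimage (s := {t | a < t ^ 2})
      (measurableSet_lt measurable_const (by fun_prop)).nullMeasurableSet
    exact this.trans_le h1
  have h3 : {x : Fin n → Fin p → ℝ | ∃ i j, a < x i j ^ 2} =
      ⋃ q : Fin n × Fin p, {x | a < x q.1 q.2 ^ 2} := by ext; simp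
  rw [h3]
  refine (measureReal_iUnion_fintype_le _).trans
    ((Finset.sum_le_sum fun q _ => h2 q.1 q.2).trans_eq ?_)
  simp

/-- Vectors whose coordinates are multiples of `1 / M` in `[-1, 1]`. -/
noncomputable def gridVectors (ι : Type*) [Fintype ι] [DecidableEq ι] (M : ℕ) :
    Finset (ι → ℝ) :=
  Fintype.piFinset fun _ => (Finset.Icc (-(M : ℤ)) M).image fun z : ℤ => (z : ℝ) / M

lemma card_gridVectors_le (ι : Type*) [Fintype ι] [DecidableEq ι] (M : ℕ) :
    (gridVectors ι M).card ≤ (2 * M + 1) ^ Fintype.card ι := by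
  rw [gridVectors, Fintype.card_piFinset, Finset.prod_const, Finset.card_univ]
  refine Nat.pow_le_pow_left (Finset.card_image_le.trans_eq ?_) _
  rw [Int.card_Icc]
  omega

lemma exists_gridVectors_near {ι : Type*} [Fintype ι] [DecidableEq ι] {M : ℕ} (hM : 0 < M)
    (u : ι → ℝ) (hu : ∑ k, u k ^ 2 = 1) :
    ∃ v ∈ gridVectors ι M, ∑ k, (u k - v k) ^ 2 ≤ Fintype.card ι / (M : ℝ) ^ 2 := by
  have hM' : (0 : ℝ) < M := by exact_mod_cast hM
  have habs : ∀ k, |u k| ≤ 1 := fun k => by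
    rw [← sq_le_one_iff_abs_le_one, ← hu]
    exact Finset.single_le_sum (f := fun k => u k ^ 2) (fun _ _ => sq_nonneg _) (Finset.mem_univ k)
  refine ⟨fun k => (⌊M * u k⌋ : ℤ) / M, ?_, ?_⟩
  · refine Fintype.mem_piFinset.2 fun k => Finset.mem_image_of_mem _ (Finset.mem_Icc.2 ⟨?_, ?_⟩)
    · rw [Int.le_floor]
      push_cast
      nlinarith [(abs_le.1 (habs k)).1]
    · have : ((⌊M * u k⌋ : ℤ) : ℝ) ≤ ((M : ℤ) : ℝ) := (Int.floor_le _).trans (by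
        push_cast
        nlinarith [(abs_le.1 (habs k)).2])
      exact_mod_cast this
  · have : ∀ k, (u k - (⌊M * u k⌋ : ℤ) / M) ^ 2 ≤ 1 / (M : ℝ) ^ 2 := fun k => by
      have h : u k - (⌊M * u k⌋ : ℤ) / M = (M * u k - ⌊M * u k⌋) / M := by field_simp
      rw [h, div_pow]
      gcongr
      have h0 := Int.floor_le (M * u k)
      have h1 := Int.lt_floor_add_one (M * u k)
      nlinarith
    refine (Finset.sum_le_sum fun k _ => this k).trans_eq ?_
    rw [Finset.sum_const, Finset.card_univ, nsmul_eq_mul, mul_one_div]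

/-- A quadratic form with bounded weights and rows that is bounded below on a fine grid is bounded
below on the unit sphere. -/
lemma weighted_form_ge_of_grid {ι : Type*} [Fintype ι] [DecidableEq ι] {n M : ℕ} (hM : 0 < M)
    (x : Fin n → ι → ℝ) (m : Fin n → ℝ) (hm0 : ∀ i, 0 ≤ m i) (hm1 : ∀ i, m i ≤ 1) (A : ℝ)
    (hA : ∀ i k, x i k ^ 2 ≤ A)
    (hMA : Fintype.card ι / (20 * (M : ℝ) ^ 2) + A * Fintype.card ι ^ 2 / (M : ℝ) ^ 2 ≤ 1 / 80)
    (hgrid : ∀ v ∈ gridVectors ι M,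
      n / 10 * ∑ k, v k ^ 2 ≤ ∑ i, m i * (∑ k, x i k * v k) ^ 2)
    (u : ι → ℝ) (hu : ∑ k, u k ^ 2 = 1) :
    (n : ℝ) / 80 ≤ ∑ i, m i * (∑ k, x i k * u k) ^ 2 := by
  obtain ⟨v, hv, huv⟩ := exists_gridVectors_near hM u hu
  have hM' : (0 : ℝ) < M := by exact_mod_cast hM
  set s := (Fintype.card ι : ℝ) with hs
  have hv2 : 1 / 2 - s / (M : ℝ) ^ 2 ≤ ∑ k, v k ^ 2 := by
    have : ∑ k, u k ^ 2 ≤ ∑ k, (2 * v k ^ 2 + 2 * (u k - v k) ^ 2) :=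
      Finset.sum_le_sum fun k _ => by nlinarith [sq_nonneg (2 * v k - u k)]
    rw [Finset.sum_add_distrib, ← Finset.mul_sum, ← Finset.mul_sum] at this
    linarith
  have hrow : ∀ i, (∑ k, x i k * v k) ^ 2 / 2 - A * s ^ 2 / (M : ℝ) ^ 2 ≤
      (∑ k, x i k * u k) ^ 2 := fun i => by
    have hcs := Finset.sum_mul_sq_le_sq_mul_sq Finset.univ (x i) fun k => u k - v k
    have hx : ∑ k, x i k ^ 2 ≤ s * A :=
      (Finset.sum_le_sum fun k _ => hA i k).trans_eq (by simp [hs])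
    have hx0 : 0 ≤ s * A := (Finset.sum_nonneg fun k _ => sq_nonneg (x i k)).trans hx
    have hd : ∑ k, x i k * (u k - v k) = ∑ k, x i k * u k - ∑ k, x i k * v k := by
      simp only [mul_sub, Finset.sum_sub_distrib]
    rw [hd] at hcs
    have h2 : (∑ k, x i k ^ 2) * ∑ k, (u k - v k) ^ 2 ≤ s * A * (s / (M : ℝ) ^ 2) := by
      gcongr
    have h3 : s * A * (s / (M : ℝ) ^ 2) = A * s ^ 2 / (M : ℝ) ^ 2 := by ring
    nlinarith [sq_nonneg (2 * ∑ k, x i k * u k - ∑ k, x i k * v k)]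
  have hE : 0 ≤ A * s ^ 2 / (M : ℝ) ^ 2 ∨ n = 0 := by
    rcases n.eq_zero_or_pos with h | h
    · exact Or.inr h
    · left
      rcases isEmpty_or_nonempty ι with hι | ⟨⟨k⟩⟩
      · simp [hs]
      · have : 0 ≤ A := (sq_nonneg _).trans (hA ⟨0, h⟩ k)
        positivity
  have hsum : (∑ i, m i * (∑ k, x i k * v k) ^ 2) / 2 - n * (A * s ^ 2 / (M : ℝ) ^ 2) ≤
      ∑ i, m i * (∑ k, x i k * u k) ^ 2 := by
    rcases hE with hE | hE
    · have : ∀ i, m i * (∑ k, x i k * v k) ^ 2 / 2 - A * s ^ 2 / (M : ℝ) ^ 2 ≤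
          m i * (∑ k, x i k * u k) ^ 2 := fun i => by
        nlinarith [mul_le_mul_of_nonneg_left (hrow i) (hm0 i),
          mul_le_mul_of_nonneg_right (hm1 i) hE]
      refine le_trans (le_of_eq ?_) (Finset.sum_le_sum fun i _ => this i)
      rw [Finset.sum_sub_distrib, ← Finset.sum_div]
      simp
    · subst hE
      simp
  have hg := hgrid v hv
  have hn : (0 : ℝ) ≤ n := n.cast_nonneg
  have h4 := mul_le_mul_of_nonneg_left hv2 (by positivity : (0 : ℝ) ≤ n / 10)
  have h5 := mul_le_mul_of_nonneg_left hMA hn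
  have h6 : s / (20 * (M : ℝ) ^ 2) = s / (M : ℝ) ^ 2 / 20 := by ring
  rw [h6] at h5
  nlinarith

lemma sq_sum_le_of_unit {ι : Type*} [Fintype ι] {c : ℝ} (Q : (ι → ℝ) → ℝ)
    (hQ : ∀ (a : ℝ) u, Q (a • u) = a ^ 2 * Q u)
    (h : ∀ u, ∑ k, u k ^ 2 = 1 → c ≤ Q u) (u : ι → ℝ) : c * ∑ k, u k ^ 2 ≤ Q u := by
  rcases (Finset.sum_nonneg fun k _ => sq_nonneg (u k) : 0 ≤ ∑ k, u k ^ 2).eq_or_lt with h0 | h0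
  · have hu : u = (0 : ℝ) • u := by
      ext k
      have := (Finset.sum_eq_zero_iff_of_nonneg fun k _ => sq_nonneg (u k)).1 h0.symm k
        (Finset.mem_univ k)
      simpa using this
    rw [← h0, hu, hQ]
    simp
  · set q := ∑ k, u k ^ 2
    have h1 := h ((√q)⁻¹ • u) (by
      simp only [Pi.smul_apply, smul_eq_mul, mul_pow, inv_pow, sq_sqrt h0.le]
      rw [← Finset.mul_sum]
      exact inv_mul_cancel₀ h0.ne')
    rw [hQ, inv_pow, sq_sqrt h0.le, inv_mul_eq_div, le_div_iff₀ h0] at h1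
    exact h1

/-- A union bound over nonempty supports, where a support of size `k` has failure probability at
most `p ^ (-3 k)`. -/
lemma measureReal_exists_support_le {α : Type*} [MeasurableSpace α] (μ : Measure α)
    {p s : ℕ} (hp : 3 ≤ p) (B : Finset (Fin p) → Set α)
    (hB : ∀ S : Finset (Fin p), S.Nonempty → S.card ≤ s → μ.real (B S) ≤ (1 / (p : ℝ) ^ 3) ^ S.card) :
    μ.real {x | ∃ S : Finset (Fin p), S.Nonempty ∧ S.card ≤ s ∧ x ∈ B S} ≤ 1 / p := by
  have hp' : (3 : ℝ) ≤ p := by exact_mod_cast hp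
  have hp0 : (0 : ℝ) < p := by linarith
  set q : ℝ := 1 / (p : ℝ) ^ 3
  have hq : 0 ≤ q := by positivity
  set F := (Finset.univ.erase (∅ : Finset (Fin p))).filter fun S => S.card ≤ s
  have hset : {x | ∃ S : Finset (Fin p), S.Nonempty ∧ S.card ≤ s ∧ x ∈ B S} = ⋃ S ∈ F, B S := by
    ext x
    simp [F, Finset.nonempty_iff_ne_empty, and_assoc]
  have hall := Fin.sum_pow_mul_eq_add_pow (n := p) q 1
  simp only [one_pow, mul_one] at hall
  rw [← Finset.add_sum_erase _ _ (Finset.mem_univ ∅), Finset.card_empty, pow_zero] at hall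
  have hexp : (q + 1) ^ p ≤ 1 + 1 / p := by
    have h1 : (q + 1) ^ p ≤ exp (1 / (p : ℝ) ^ 2) := by
      refine (pow_le_pow_left₀ (by positivity) (add_one_le_exp q) p).trans_eq ?_
      rw [← exp_nat_mul]
      congr 1
      simp only [q]
      field_simp
    have hz0 : (0 : ℝ) ≤ 1 / (p : ℝ) ^ 2 := by positivity
    have hz1 : 1 / (p : ℝ) ^ 2 ≤ 1 := by
      rw [div_le_one (by positivity)]
      nlinarith
    have h2 := (abs_le.1 (abs_exp_sub_one_sub_id_le (abs_le.2 ⟨by linarith, hz1⟩))).2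
    have h3 : 2 * (1 / (p : ℝ) ^ 2) ≤ 1 / p := by
      rw [mul_one_div, div_le_div_iff₀ (by positivity) hp0]
      nlinarith
    nlinarith
  rw [hset]
  calc μ.real (⋃ S ∈ F, B S) ≤ ∑ S ∈ F, μ.real (B S) := measureReal_biUnion_finset_le _ _
    _ ≤ ∑ S ∈ F, q ^ S.card := Finset.sum_le_sum fun S hS => by
        simp only [F, Finset.mem_filter, Finset.mem_erase, Finset.mem_univ, and_true] at hS
        exact hB S (Finset.nonempty_iff_ne_empty.2 hS.1) hS.2
    _ ≤ ∑ S ∈ Finset.univ.erase (∅ : Finset (Fin p)), q ^ S.card :=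
        Finset.sum_le_sum_of_subset_of_nonneg (Finset.filter_subset _ _)
          fun _ _ _ => pow_nonneg hq _
    _ ≤ 1 / p := by linarith

lemma sum_dite_mem_eq {p : ℕ} {R : Type*} [AddCommMonoid R] (S : Finset (Fin p)) (f : S → R) :
    ∑ j, (if h : j ∈ S then f ⟨j, h⟩ else 0) = ∑ k, f k := by
  rw [← Finset.sum_subset S.subset_univ fun j _ hj => dif_neg hj, ← Finset.sum_coe_sort S]
  exact Finset.sum_congr rfl fun k _ => dif_pos k.2

/-- Failure probability of the grid lower bound on a fixed support. -/
lemma gaussMat_exists_grid_lt_le {n p : ℕ} (θ : Fin p → ℝ) (S : Finset (Fin p)) (M : ℕ) :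
    (gaussMat n p).real {x | ∃ v ∈ gridVectors S M,
      ∑ i, min 1 (exp (∑ j, x i j * θ j)) * (∑ k : S, x i k * v k) ^ 2 <
        n / 10 * ∑ k, v k ^ 2} ≤ (2 * M + 1 : ℝ) ^ S.card * exp (-(n / 10)) := by
  have hset : {x : Fin n → Fin p → ℝ | ∃ v ∈ gridVectors S M,
      ∑ i, min 1 (exp (∑ j, x i j * θ j)) * (∑ k : S, x i k * v k) ^ 2 <
        n / 10 * ∑ k, v k ^ 2} = ⋃ v ∈ gridVectors S M, {x |
      ∑ i, min 1 (exp (∑ j, x i j * θ j)) * (∑ k : S, x i k * v k) ^ 2 <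
        n / 10 * ∑ k, v k ^ 2} := by ext; simp
  have hfix : ∀ v : S → ℝ, (gaussMat n p).real {x |
      ∑ i, min 1 (exp (∑ j, x i j * θ j)) * (∑ k : S, x i k * v k) ^ 2 <
        n / 10 * ∑ k, v k ^ 2} ≤ exp (-(n / 10)) := fun v => by
    have h := gaussMat_weighted_form_lt_le (n := n) θ fun j => if h : j ∈ S then v ⟨j, h⟩ else 0
    have h1 : ∀ y : Fin p → ℝ, ∑ j, y j * (if h : j ∈ S then v ⟨j, h⟩ else 0) =
        ∑ k : S, y k * v k := fun y => by
      rw [← sum_dite_mem_eq S]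
      exact Finset.sum_congr rfl fun j _ => by split_ifs <;> simp
    have h2 : ∑ j, (if h : j ∈ S then v ⟨j, h⟩ else 0) ^ 2 = ∑ k, v k ^ 2 := by
      rw [← sum_dite_mem_eq S]
      exact Finset.sum_congr rfl fun j _ => by split_ifs <;> simp
    simp_rw [h1, h2] at h
    exact h
  rw [hset]
  refine (measureReal_biUnion_finset_le _ _).trans
    ((Finset.sum_le_card_nsmul _ _ _ fun v _ => hfix v).trans ?_)
  rw [nsmul_eq_mul]
  gcongr
  have := card_gridVectors_le S M
  rw [Fintype.card_coe] at this
  exact_mod_cast this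

lemma hasSum_exp_mul_poisson (l t : ℝ) :
    HasSum (fun k : ℕ => exp (-l) * l ^ k / k.factorial * exp (t * (k - l)))
      (exp (l * (exp t - 1 - t))) := by
  have h := (NormedSpace.expSeries_div_hasSum_exp (l * exp t)).mul_left (exp (-l - t * l))
  rw [← exp_eq_exp_ℝ, ← exp_add] at h
  convert! h using 1
  · ext k
    rw [mul_pow, ← exp_nat_mul, sub_eq_add_neg (-l), exp_add,
      show t * (k - l) = k * t + -(t * l) by ring, exp_add]
    ring
  · congr 1
    ring

lemma integrable_exp_mul_poissonMeasure {l : ℝ} (hl : 0 ≤ l) (t : ℝ) :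
    Integrable (fun k : ℕ => exp (t * (k - l))) (poissonMeasure l.toNNReal) := by
  rw [integrable_poissonMeasure_iff]
  simp only [coe_toNNReal l hl, norm_of_nonneg (exp_pos _).le]
  exact (hasSum_exp_mul_poisson l t).summable

lemma integral_exp_mul_poissonMeasure_le {l : ℝ} (hl : 0 ≤ l) {t : ℝ} (ht : |t| ≤ 1) :
    ∫ k : ℕ, exp (t * (k - l)) ∂poissonMeasure l.toNNReal ≤ exp (l * t ^ 2) := by
  rw [integral_poissonMeasure]
  simp only [coe_toNNReal l hl, smul_eq_mul]
  rw [(hasSum_exp_mul_poisson l t).tsum_eq]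
  gcongr
  exact (abs_le.1 (abs_exp_sub_one_sub_id_le ht)).2

/-- Bernstein-type upper tail for a linear combination of centred Poisson variables. -/
lemma pi_poissonMeasure_sum_ge_le {ι : Type*} [Fintype ι] (w b : ι → ℝ) (hw : ∀ i, 0 ≤ w i)
    {t R : ℝ} (htb : ∀ i, |t * b i| ≤ 1) (hR : ∑ i, w i * b i ^ 2 ≤ R) (ht : 0 < t) (τ : ℝ) :
    (Measure.pi fun i => poissonMeasure (w i).toNNReal).real
      {y : ι → ℕ | τ ≤ ∑ i, ((y i : ℝ) - w i) * b i} ≤ exp (t ^ 2 * R - t * τ) := by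
  have h := measureReal_pi_sum_ge_le (fun i => poissonMeasure (w i).toNNReal)
    (fun i k => t * b i * ((k : ℝ) - w i)) (fun i => w i * (t * b i) ^ 2) (t * τ)
    (fun i => integrable_exp_mul_poissonMeasure (hw i) _)
    fun i => integral_exp_mul_poissonMeasure_le (hw i) (htb i)
  refine (measureReal_mono ?_).trans (h.trans ?_)
  · intro y hy
    rw [Set.mem_ofPred_eq] at hy ⊢
    calc t * τ ≤ t * ∑ i, ((y i : ℝ) - w i) * b i := by gcongr
      _ = _ := by rw [Finset.mul_sum]; exact Finset.sum_congr rfl fun i _ => by ring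
  · gcongr
    calc ∑ i, w i * (t * b i) ^ 2 = t ^ 2 * ∑ i, w i * b i ^ 2 := by
          rw [Finset.mul_sum]; exact Finset.sum_congr rfl fun i _ => by ring
      _ ≤ _ := by gcongr

/-- Whitening: a positive definite matrix has an inverse square root. -/
lemma exists_whitening {ι : Type*} [Fintype ι] [DecidableEq ι] {V : Matrix ι ι ℝ} (hV : V.PosDef) :
    ∃ D : Matrix ι ι ℝ, Dᵀ * V * D = 1 ∧ V⁻¹ = D * Dᵀ := by
  open scoped MatrixOrder in
  obtain ⟨B, hB⟩ := CStarAlgebra.nonneg_iff_eq_star_mul_self.mp hV.posSemidef.nonneg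
  rw [star_eq_conjTranspose, conjTranspose_eq_transpose_of_trivial] at hB
  have hdet : IsUnit B.det := by
    have := hV.det_pos
    rw [hB, det_mul, det_transpose] at this
    exact isUnit_iff_ne_zero.2 (left_ne_zero_of_mul this.ne')
  refine ⟨B⁻¹, ?_, ?_⟩
  · rw [hB, transpose_nonsing_inv, ← mul_assoc, nonsing_inv_mul _ (by rwa [det_transpose]), one_mul,
      mul_nonsing_inv _ hdet]
  · rw [hB, Matrix.mul_inv_rev, transpose_nonsing_inv]

lemma dotProduct_gramMatrix_mulVec {ι κ : Type*} [Fintype ι] [Fintype κ] (w : κ → ℝ)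
    (x : κ → ι → ℝ) (u : ι → ℝ) :
    u ⬝ᵥ (Matrix.of fun j k => ∑ i, w i * x i j * x i k) *ᵥ u =
      ∑ i, w i * (∑ k, x i k * u k) ^ 2 := by
  simp only [dotProduct, mulVec, of_apply, Finset.sum_mul, Finset.mul_sum, sq]
  rw [Finset.sum_congr rfl fun j _ => Finset.sum_comm, Finset.sum_comm]
  exact Finset.sum_congr rfl fun i _ => Finset.sum_congr rfl fun j _ =>
    Finset.sum_congr rfl fun k _ => by ring

lemma posDef_gramMatrix {ι κ : Type*} [Fintype ι] [Fintype κ] (w : κ → ℝ)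
    (x : κ → ι → ℝ) {c : ℝ} (hc : 0 < c)
    (hV : ∀ u : ι → ℝ, c * ∑ k, u k ^ 2 ≤ ∑ i, w i * (∑ k, x i k * u k) ^ 2) :
    (Matrix.of fun j k => ∑ i, w i * x i j * x i k).PosDef := by
  refine .of_dotProduct_mulVec_pos ?_ fun u hu => ?_
  · ext j k
    simp only [conjTranspose_apply, of_apply, star_trivial]
    exact Finset.sum_congr rfl fun i _ => by ring
  · rw [star_trivial, dotProduct_gramMatrix_mulVec]
    refine lt_of_lt_of_le (mul_pos hc ?_) (hV u)
    obtain ⟨k, hk⟩ := Function.ne_iff.1 hu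
    exact Finset.sum_pos' (fun k _ => sq_nonneg (u k)) ⟨k, Finset.mem_univ k, sq_pos_of_ne_zero hk⟩

/-- If the norm of `W` exceeds `2 τ`, some grid vector of norm at most `3 / 2` has inner product at
least `τ` with `W`. -/
lemma exists_gridVectors_dotProduct_ge {ι : Type*} [Fintype ι] [DecidableEq ι] {M : ℕ} (hM : 0 < M)
    (hcard : Fintype.card ι / (M : ℝ) ^ 2 ≤ 1 / 4) (W : ι → ℝ) {τ : ℝ} (hτ : 0 ≤ τ)
    (hW : 2 * τ < √(∑ k, W k ^ 2)) :
    ∃ v ∈ gridVectors ι M, ∑ k, v k ^ 2 ≤ 9 / 4 ∧ τ ≤ ∑ k, W k * v k := by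
  set N := √(∑ k, W k ^ 2)
  have hN : 0 < N := by linarith
  have hN2 : N ^ 2 = ∑ k, W k ^ 2 := sq_sqrt (Finset.sum_nonneg fun k _ => sq_nonneg (W k))
  have hu : ∑ k, (W k / N) ^ 2 = 1 := by
    simp only [div_pow]
    rw [← Finset.sum_div, ← hN2]
    exact div_self (by positivity)
  obtain ⟨v, hv, hd⟩ := exists_gridVectors_near hM (fun k => W k / N) hu
  replace hd := hd.trans hcard
  refine ⟨v, hv, ?_, ?_⟩
  · have : ∑ k, v k ^ 2 ≤ ∑ k, (3 / 2 * (W k / N) ^ 2 + 3 * (W k / N - v k) ^ 2) :=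
      Finset.sum_le_sum fun k _ => by
        nlinarith [sq_nonneg (3 * (W k / N) - 2 * v k)]
    rw [Finset.sum_add_distrib, ← Finset.mul_sum, ← Finset.mul_sum, hu] at this
    linarith
  · have hcs := Finset.sum_mul_sq_le_sq_mul_sq Finset.univ W fun k => W k / N - v k
    rw [← hN2] at hcs
    have h1 : ∑ k, W k * (W k / N - v k) = N - ∑ k, W k * v k := by
      simp only [mul_sub, Finset.sum_sub_distrib]
      congr 1
      simp only [← mul_div_assoc, ← sq]
      rw [← Finset.sum_div, ← hN2]
      field_simp
    have h2 : (∑ k, W k * (W k / N - v k)) ^ 2 ≤ (N / 2) ^ 2 := by nlinarith [sq_nonneg N]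
    have := (abs_le_of_sq_le_sq' h2 (by positivity)).2
    linarith

/-- Deviation bound for the normalised Poisson score on a fixed support, conditionally on a design
whose weighted Gram matrix is bounded below by `c`. -/
lemma pi_poissonMeasure_score_gt_le {ι κ : Type*} [Fintype ι] [DecidableEq ι] [Fintype κ]
    (w : κ → ℝ) (hw : ∀ i, 0 ≤ w i) (x : κ → ι → ℝ) {c A t : ℝ} {M : ℕ} (hc : 0 < c) (ht : 0 < t)
    (hM : 0 < M) (hcard : Fintype.card ι / (M : ℝ) ^ 2 ≤ 1 / 4) (hA : ∀ i k, x i k ^ 2 ≤ A)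
    (hV : ∀ u : ι → ℝ, c * ∑ k, u k ^ 2 ≤ ∑ i, w i * (∑ k, x i k * u k) ^ 2)
    (htA : t ^ 2 * (Fintype.card ι * A) * (9 / 4) ≤ c) :
    (Measure.pi fun i => poissonMeasure (w i).toNNReal).real {y : κ → ℕ | 18 * t <
      √((fun k => ∑ i, ((y i : ℝ) - w i) * x i k) ⬝ᵥ
        (Matrix.of fun j k => ∑ i, w i * x i j * x i k)⁻¹ *ᵥ
          fun k => ∑ i, ((y i : ℝ) - w i) * x i k)} ≤
      (2 * M + 1 : ℝ) ^ Fintype.card ι * exp (-(27 / 4 * t ^ 2)) := by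
  set V : Matrix ι ι ℝ := Matrix.of fun j k => ∑ i, w i * x i j * x i k with hVdef
  obtain ⟨D, hD1, hD2⟩ := exists_whitening (posDef_gramMatrix w x hc hV)
  set b : (ι → ℝ) → κ → ℝ := fun v i => ∑ k, x i k * (D *ᵥ v) k
  have hform : ∀ v, ∑ i, w i * b v i ^ 2 = ∑ k, v k ^ 2 := fun v => by
    rw [← dotProduct_gramMatrix_mulVec, ← hVdef]
    nth_rewrite 1 [← vecMul_transpose]
    rw [← dotProduct_mulVec, mulVec_mulVec, mulVec_mulVec, hD1, one_mulVec]
    simp only [dotProduct, sq]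
  have hfix : ∀ v : ι → ℝ, ∑ k, v k ^ 2 ≤ 9 / 4 →
      (Measure.pi fun i => poissonMeasure (w i).toNNReal).real
        {y : κ → ℕ | 9 * t ≤ ∑ i, ((y i : ℝ) - w i) * b v i} ≤ exp (-(27 / 4 * t ^ 2)) := by
    intro v hv
    refine (pi_poissonMeasure_sum_ge_le w (b v) hw (t := t) (R := 9 / 4) (fun i => ?_)
      ((hform v).trans_le hv) ht (9 * t)).trans_eq (by congr 1; ring)
    rw [← sq_le_one_iff_abs_le_one, mul_pow]
    have hcs := Finset.sum_mul_sq_le_sq_mul_sq Finset.univ (x i) (D *ᵥ v)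
    have hx : ∑ k, x i k ^ 2 ≤ Fintype.card ι * A :=
      (Finset.sum_le_sum fun k _ => hA i k).trans_eq (by simp)
    have hx0 := (Finset.sum_nonneg fun k _ => sq_nonneg (x i k)).trans hx
    have hDv : c * ∑ k, (D *ᵥ v) k ^ 2 ≤ 9 / 4 := (hV _).trans ((hform v).trans_le hv)
    have hDv0 : 0 ≤ ∑ k, (D *ᵥ v) k ^ 2 := Finset.sum_nonneg fun k _ => sq_nonneg _
    calc t ^ 2 * b v i ^ 2 ≤ t ^ 2 * (Fintype.card ι * A * ∑ k, (D *ᵥ v) k ^ 2) := by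
          gcongr
          exact hcs.trans (by gcongr)
      _ = t ^ 2 * (Fintype.card ι * A) * (9 / 4) * (4 / 9 * ∑ k, (D *ᵥ v) k ^ 2) := by ring
      _ ≤ c * (4 / 9 * ∑ k, (D *ᵥ v) k ^ 2) := by gcongr
      _ ≤ 1 := by linarith
  refine (measureReal_mono (s₂ := ⋃ v ∈ (gridVectors ι M).filter fun v => ∑ k, v k ^ 2 ≤ 9 / 4,
    {y : κ → ℕ | 9 * t ≤ ∑ i, ((y i : ℝ) - w i) * b v i}) ?_ (measure_ne_top _ _)).trans ?_
  · intro y hy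
    set Z : ι → ℝ := fun k => ∑ i, ((y i : ℝ) - w i) * x i k
    rw [Set.mem_ofPred_eq, hD2, ← mulVec_mulVec, dotProduct_mulVec, ← mulVec_transpose] at hy
    have hsq : Dᵀ *ᵥ Z ⬝ᵥ Dᵀ *ᵥ Z = ∑ k, (Dᵀ *ᵥ Z) k ^ 2 := by simp only [dotProduct, sq]
    rw [hsq] at hy
    obtain ⟨v, hv, hv2, hZv⟩ := exists_gridVectors_dotProduct_ge hM hcard (Dᵀ *ᵥ Z) (τ := 9 * t)
      (by positivity) (by linarith)
    simp only [Set.mem_iUnion, Finset.mem_filter]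
    refine ⟨v, ⟨hv, hv2⟩, hZv.trans_eq ?_⟩
    have : ∑ k, (Dᵀ *ᵥ Z) k * v k = Z ⬝ᵥ D *ᵥ v := by
      rw [dotProduct_mulVec, ← mulVec_transpose]; rfl
    rw [this]
    simp only [Z, b, dotProduct, Finset.sum_mul, Finset.mul_sum]
    rw [Finset.sum_comm]
    simp only [mul_assoc]
  · refine (measureReal_biUnion_finset_le _ _).trans
      ((Finset.sum_le_card_nsmul _ _ _ fun v hv => hfix v (Finset.mem_filter.1 hv).2).trans ?_)
    rw [nsmul_eq_mul]
    gcongr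
    exact_mod_cast (Finset.card_filter_le _ _).trans (card_gridVectors_le ι M)

lemma one_sub_ofReal_add_le_compProd {α β : Type*} [MeasurableSpace α] [MeasurableSpace β]
    (μ : Measure α) [IsProbabilityMeasure μ] (κ : Kernel α β) [IsMarkovKernel κ] (E : Set (α × β))
    (G : Set α) {a b : ℝ} (ha : 0 ≤ a) (hb : 0 ≤ b) (hG : μ.real Gᶜ ≤ a)
    (hE : ∀ x ∈ G, (κ x).real {y | (x, y) ∉ E} ≤ b) :
    1 - ENNReal.ofReal (a + b) ≤ (μ.compProd κ) E := by
  set H := (toMeasurable μ Gᶜ)ᶜ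
  have hHm : MeasurableSet H := (measurableSet_toMeasurable μ Gᶜ).compl
  have hHG : H ⊆ G := Set.compl_subset_comm.1 (subset_toMeasurable μ Gᶜ)
  have hμH : 1 - ENNReal.ofReal a ≤ μ H := by
    rw [prob_compl_eq_one_sub (measurableSet_toMeasurable μ Gᶜ), measure_toMeasurable]
    exact tsub_le_tsub_left ((ENNReal.le_ofReal_iff_toReal_le (measure_ne_top _ _) ha).2 hG) _
  have hκ : ∀ x ∈ H, 1 - ENNReal.ofReal b ≤ κ x {y | (x, y) ∈ E} := fun x hx => by
    rw [tsub_le_iff_right]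
    calc (1 : ENNReal) = κ x Set.univ := measure_univ.symm
      _ ≤ κ x ({y | (x, y) ∈ E} ∪ {y | (x, y) ∉ E}) := measure_mono fun y _ => em _
      _ ≤ κ x {y | (x, y) ∈ E} + κ x {y | (x, y) ∉ E} := measure_union_le _ _
      _ ≤ _ := by
        gcongr
        exact (ENNReal.le_ofReal_iff_toReal_le (measure_ne_top _ _) hb).2 (hE x (hHG hx))
  have hlow : (1 - ENNReal.ofReal b) * (1 - ENNReal.ofReal a) ≤ (μ.compProd κ) E :=
    calc (1 - ENNReal.ofReal b) * (1 - ENNReal.ofReal a) ≤ (1 - ENNReal.ofReal b) * μ H := by gcongr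
      _ = ∫⁻ _ in H, (1 - ENNReal.ofReal b) ∂μ := (setLIntegral_const _ _).symm
      _ ≤ ∫⁻ x in H, κ x {y | (x, y) ∈ E} ∂μ := setLIntegral_mono' hHm hκ
      _ ≤ ∫⁻ x, κ x {y | (x, y) ∈ E} ∂μ := setLIntegral_le_lintegral _ _
      _ ≤ (μ.compProd κ) E := by
        simpa [Measure.compProd] using
          Kernel.le_compProd_apply (Kernel.const Unit μ) (Kernel.prodMkLeft Unit κ) () E
  refine le_trans ?_ hlow
  rw [ENNReal.ofReal_add ha hb, tsub_le_iff_right]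
  set α' := ENNReal.ofReal a
  set β' := ENNReal.ofReal b
  calc (1 : ENNReal) ≤ (1 - β') + β' := le_tsub_add
    _ ≤ (1 - β') * ((1 - α') + α') + β' := by
        gcongr
        exact le_mul_of_one_le_right' le_tsub_add
    _ ≤ (1 - β') * (1 - α') + α' + β' := by
        rw [mul_add]
        gcongr
        exact mul_le_of_le_one_left' tsub_le_self
    _ = _ := by rw [add_assoc]

lemma sampleSize_bounds {n p s : ℕ} (hs : 1 ≤ s) (hp : 3 ≤ p)
    (hn : 10000 * ((s : ℝ) * log (max n p : ℕ)) ^ 2 ≤ n) :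
    1 ≤ log (max n p : ℕ) ∧ log (max n p : ℕ) ≤ (max n p : ℕ) ∧ (10000 : ℝ) ≤ n ∧
      10000 * ((s : ℝ) * log (max n p : ℕ)) ≤ n := by
  have hN : (3 : ℝ) ≤ (max n p : ℕ) := by exact_mod_cast hp.trans (le_max_right n p)
  have hL : 1 ≤ log (max n p : ℕ) := by
    rw [le_log_iff_exp_le (by linarith)]
    linarith [exp_one_lt_three]
  have hs' : (1 : ℝ) ≤ s := by exact_mod_cast hs
  have h1 : 1 ≤ (s : ℝ) * log (max n p : ℕ) := one_le_mul_of_one_le_of_one_le hs' hL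
  refine ⟨hL, ?_, ?_, ?_⟩
  · linarith [log_le_sub_one_of_pos (by linarith : (0 : ℝ) < (max n p : ℕ))]
  · nlinarith
  · nlinarith

/-- With high probability the Gaussian design has bounded entries and its weighted Gram matrices
are uniformly bounded below over all small supports. -/
lemma gaussMat_not_regular_le {n p s : ℕ} (hs : 1 ≤ s) (hsp : s ≤ p) (hp : 3 ≤ p)
    (θ : Fin p → ℝ) (hn : 10000 * ((s : ℝ) * log (max n p : ℕ)) ^ 2 ≤ n) :
    (gaussMat n p).real {x | (∀ i j, x i j ^ 2 ≤ 16 * log (max n p : ℕ)) ∧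
      ∀ S : Finset (Fin p), S.Nonempty → S.card ≤ s → ∀ u : S → ℝ, n / 80 * ∑ k, u k ^ 2 ≤
        ∑ i, exp (∑ j, x i j * θ j) * (∑ k : S, x i k * u k) ^ 2}ᶜ ≤ 2 / p := by
  obtain ⟨hL1, hLN, hn4, hsn⟩ := sampleSize_bounds hs hp hn
  set N := max n p
  set L := log (N : ℕ)
  have hnN : (n : ℝ) ≤ N := by exact_mod_cast le_max_left n p
  have hpN : (p : ℝ) ≤ N := by exact_mod_cast le_max_right n p
  have hp' : (3 : ℝ) ≤ p := by exact_mod_cast hp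
  have hN0 : (0 : ℝ) < N := by linarith
  set B : Finset (Fin p) → Set (Fin n → Fin p → ℝ) := fun S => {x | ∃ v ∈ gridVectors S (N ^ 2),
    ∑ i, min 1 (exp (∑ j, x i j * θ j)) * (∑ k : S, x i k * v k) ^ 2 < n / 10 * ∑ k, v k ^ 2}
  have hentries : (gaussMat n p).real {x | ∃ i j, 16 * L < x i j ^ 2} ≤ 1 / p := by
    refine (gaussMat_exists_sq_gt_le (16 * L)).trans ?_
    have h1 : exp (-(16 * L / 4)) = 1 / (N : ℝ) ^ 4 := by
      rw [show -(16 * L / 4) = -((4 : ℕ) * L) by push_cast; ring, exp_neg, exp_nat_mul,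
        exp_log hN0, one_div]
    rw [h1, ← mul_div_assoc, ← mul_div_assoc, div_le_div_iff₀ (by positivity) (by linarith)]
    have h2 : (n : ℝ) * p * p ≤ N * N * N := by gcongr
    nlinarith [pow_pos hN0 3]
  have hgram : (gaussMat n p).real
      {x | ∃ S : Finset (Fin p), S.Nonempty ∧ S.card ≤ s ∧ x ∈ B S} ≤ 1 / p := by
    refine measureReal_exists_support_le _ hp B fun S hS hSs => ?_
    refine (gaussMat_exists_grid_lt_le θ S (N ^ 2)).trans ?_
    have h1 : exp (-(n / 10)) ≤ (1 / (N : ℝ) ^ 6) ^ S.card := by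
      have : (1 / (N : ℝ) ^ 6) = exp (-(6 * L)) := by
        rw [show -(6 * L) = -((6 : ℕ) * L) by push_cast; ring, exp_neg, exp_nat_mul,
          exp_log hN0, one_div]
      rw [this, ← exp_nat_mul, exp_le_exp]
      have h2 : (S.card : ℝ) * L ≤ s * L := by gcongr
      nlinarith
    calc (2 * (N ^ 2 : ℕ) + 1 : ℝ) ^ S.card * exp (-(n / 10))
        ≤ (2 * (N ^ 2 : ℕ) + 1 : ℝ) ^ S.card * (1 / (N : ℝ) ^ 6) ^ S.card := by gcongr
      _ = ((2 * (N : ℝ) ^ 2 + 1) * (1 / (N : ℝ) ^ 6)) ^ S.card := by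
          rw [← mul_pow]
          push_cast
          rfl
      _ ≤ (1 / (p : ℝ) ^ 3) ^ S.card := by
          refine pow_le_pow_left₀ (by positivity) ?_ _
          rw [mul_one_div, div_le_div_iff₀ (by positivity) (by positivity), one_mul]
          calc (2 * (N : ℝ) ^ 2 + 1) * (p : ℝ) ^ 3 ≤ (N : ℝ) ^ 3 * (N : ℝ) ^ 3 := by
                gcongr
                nlinarith
            _ = _ := by ring
  refine (measureReal_mono (s₂ := {x | ∃ i j, 16 * L < x i j ^ 2} ∪
    {x | ∃ S : Finset (Fin p), S.Nonempty ∧ S.card ≤ s ∧ x ∈ B S}) ?_ (measure_ne_top _ _)).trans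
    ((measureReal_union_le _ _).trans ((add_le_add hentries hgram).trans_eq (by ring)))
  rw [Set.compl_subset_comm]
  intro x hx
  simp only [Set.compl_union, Set.mem_inter_iff, Set.mem_compl_iff, Set.mem_ofPred_eq, not_exists,
    not_and, not_lt, B] at hx
  obtain ⟨hx1, hx2⟩ := hx
  refine ⟨hx1, fun S hS hSs => ?_⟩
  refine sq_sum_le_of_unit (fun u : S → ℝ => ∑ i, exp (∑ j, x i j * θ j) *
    (∑ k : S, x i k * u k) ^ 2) (fun a u => ?_) fun u hu => ?_
  · have h : ∀ i, ∑ k : S, x i k * (a • u) k = a * ∑ k : S, x i k * u k := fun i => by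
      rw [Finset.mul_sum]
      exact Finset.sum_congr rfl fun k _ => by simp only [Pi.smul_apply, smul_eq_mul]; ring
    simp only [h]
    rw [Finset.mul_sum]
    exact Finset.sum_congr rfl fun i _ => by ring
  · have hSN : (S.card : ℝ) ≤ N := le_trans (by exact_mod_cast hSs.trans hsp) hpN
    have hMA : (Fintype.card S : ℝ) / (20 * ((N ^ 2 : ℕ) : ℝ) ^ 2) +
        16 * L * (Fintype.card S : ℝ) ^ 2 / ((N ^ 2 : ℕ) : ℝ) ^ 2 ≤ 1 / 80 := by
      rw [Fintype.card_coe]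
      push_cast
      have hN4 : (10000 : ℝ) ≤ N := hn4.trans hnN
      have h1 : (S.card : ℝ) / (20 * ((N : ℝ) ^ 2) ^ 2) ≤ 1 / 160 := by
        rw [div_le_div_iff₀ (by positivity) (by norm_num)]
        have : (N : ℝ) * 10000 ^ 3 ≤ N * (N : ℝ) ^ 3 := by gcongr
        nlinarith
      have h2 : 16 * L * (S.card : ℝ) ^ 2 / ((N : ℝ) ^ 2) ^ 2 ≤ 1 / 160 := by
        rw [div_le_div_iff₀ (by positivity) (by norm_num)]
        have h3 : L * (S.card : ℝ) ^ 2 ≤ N * (N : ℝ) ^ 2 := by gcongr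
        nlinarith [pow_pos hN0 3]
      linarith
    refine (weighted_form_ge_of_grid (by have := hp.trans (le_max_right n p); positivity)
      (fun i (k : S) => x i k) (fun i => min 1 (exp (∑ j, x i j * θ j))) (fun i => by positivity)
      (fun i => min_le_left _ _) (16 * L) (fun i k => hx1 i k) hMA (hx2 S hS hSs) u hu).trans ?_
    gcongr with i
    exact min_le_right _ _

/-- uniform bound on the normalized score `‖V_{n,S}^{-1/2}·∑ᵢ εᵢ X_{i,S}‖₂`
in Poisson regression with Gaussian design.  The joint law of `(X, Y)` is the composition of
the Gaussian design law with the Poisson regression kernel `κ`; note that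
`‖V^{-1/2}v‖₂ = √(vᵀ V⁻¹ v)`. -/
theorem stmt_19 : ∃ C K : ℝ, 0 < C ∧ 0 < K ∧
    ∀ n p sstar : ℕ, 1 ≤ n → 1 ≤ sstar → sstar ≤ p → 3 ≤ p →
    ∀ θ₀ : Fin p → ℝ,
      C * ((sstar : ℝ) * Real.log (max n p : ℕ)) ^ 2 ≤ (n : ℝ) →
      ∀ κ : Kernel (Fin n → Fin p → ℝ) (Fin n → ℕ), IsMarkovKernel κ →
        (∀ x, κ x = Measure.pi fun i =>
          poissonMeasure (Real.exp (∑ j, x i j * θ₀ j)).toNNReal) →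
        1 - ENNReal.ofReal (5 * Real.exp (-(n : ℝ) / 24) + 3 / p) ≤
          ((gaussMat n p).compProd κ) {xy | ∀ S : Finset (Fin p), S.Nonempty → S.card ≤ sstar →
            (gramW S (fun i => Real.exp (∑ j, xy.1 i j * θ₀ j)) xy.1).PosDef ∧
            Real.sqrt
                ((fun k : S => ∑ i, ((xy.2 i : ℝ) - Real.exp (∑ j, xy.1 i j * θ₀ j)) * xy.1 i k.1)
                  ⬝ᵥ (gramW S (fun i => Real.exp (∑ j, xy.1 i j * θ₀ j)) xy.1)⁻¹.mulVec
                    fun k : S => ∑ i, ((xy.2 i : ℝ) - Real.exp (∑ j, xy.1 i j * θ₀ j)) * xy.1 i k.1)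
              ≤ K * Real.sqrt ((S.card : ℝ) * Real.log p)} := by
  refine ⟨10000, 18, by norm_num, by norm_num, fun n p s _ hs hsp hp θ hn κ hκ hκeq => ?_⟩
  obtain ⟨hL1, hLN, hn4, hsn⟩ := sampleSize_bounds hs hp hn
  have hp' : (3 : ℝ) ≤ p := by exact_mod_cast hp
  have hp0 : (0 : ℝ) < p := by linarith
  have hlp : 0 < log p := log_pos (by linarith)
  have hlpL : log p ≤ log (max n p : ℕ) :=
    log_le_log hp0 (by exact_mod_cast le_max_right n p)
  have hcn : (0 : ℝ) < n / 80 := by linarith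
  refine le_trans (tsub_le_tsub_left (ENNReal.ofReal_le_ofReal ?_) 1)
    (one_sub_ofReal_add_le_compProd (gaussMat n p) κ _ _ (a := 2 / p) (b := 1 / p) (by positivity)
      (by positivity) (gaussMat_not_regular_le hs hsp hp θ hn) ?_)
  · have : (0 : ℝ) < 5 * exp (-(n : ℝ) / 24) := by positivity
    have h3 : (2 : ℝ) / p + 1 / p = 3 / p := by ring
    linarith
  rintro x ⟨hx1, hx2⟩
  rw [hκeq x]
  refine (measureReal_mono ?_ (measure_ne_top _ _)).trans
    (measureReal_exists_support_le (s := s) _ hp (fun S : Finset (Fin p) => {y : Fin n → ℕ |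
      18 * √((S.card : ℝ) * log p) <
        √((fun k : S => ∑ i, ((y i : ℝ) - exp (∑ j, x i j * θ j)) * x i k.1) ⬝ᵥ
          (gramW S (fun i => exp (∑ j, x i j * θ j)) x)⁻¹ *ᵥ
            fun k : S => ∑ i, ((y i : ℝ) - exp (∑ j, x i j * θ j)) * x i k.1)})
      fun S hS hSs => ?_)
  · intro y hy
    by_contra hcon
    refine hy fun S hS hSs => ⟨posDef_gramMatrix _ (fun i (k : S) => x i k) hcn (hx2 S hS hSs), ?_⟩
    by_contra hlt
    exact hcon ⟨S, hS, hSs, not_le.1 hlt⟩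
  · have hS1 : (1 : ℝ) ≤ S.card := by exact_mod_cast hS.card_pos
    have hSs' : (S.card : ℝ) ≤ s := by exact_mod_cast hSs
    have hSp : (S.card : ℝ) ≤ p := by exact_mod_cast hSs.trans hsp
    have ht2 : √((S.card : ℝ) * log p) ^ 2 = S.card * log p := sq_sqrt (by positivity)
    refine (pi_poissonMeasure_score_gt_le (fun i => exp (∑ j, x i j * θ j))
      (fun i => (exp_pos _).le) (fun i (k : S) => x i k) (M := p ^ 2) hcn
      (sqrt_pos.2 (by positivity)) (by positivity) ?_ (fun i k => hx1 i k) (hx2 S hS hSs)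
      ?_).trans ?_
    · rw [Fintype.card_coe, div_le_div_iff₀ (by positivity) (by norm_num)]
      push_cast
      have : (p : ℝ) * 3 ^ 3 ≤ p * (p : ℝ) ^ 3 := by gcongr
      nlinarith
    · rw [Fintype.card_coe, ht2]
      have h1 : (S.card : ℝ) * log p * (S.card * (16 * log (max n p : ℕ))) * (9 / 4) ≤
          s * log (max n p : ℕ) * (s * (16 * log (max n p : ℕ))) * (9 / 4) := by gcongr
      nlinarith
    · rw [Fintype.card_coe, ht2]
      have h1 : exp (-(27 / 4 * (S.card * log p))) ≤ (1 / (p : ℝ) ^ 6) ^ S.card := by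
        have : (1 / (p : ℝ) ^ 6) = exp (-(6 * log p)) := by
          rw [show -(6 * log p) = -((6 : ℕ) * log p) by push_cast; ring, exp_neg, exp_nat_mul,
            exp_log hp0, one_div]
        rw [this, ← exp_nat_mul, exp_le_exp]
        nlinarith [mul_pos (by linarith : (0 : ℝ) < S.card) hlp]
      calc (2 * (p ^ 2 : ℕ) + 1 : ℝ) ^ S.card * exp (-(27 / 4 * (S.card * log p)))
          ≤ (2 * (p ^ 2 : ℕ) + 1 : ℝ) ^ S.card * (1 / (p : ℝ) ^ 6) ^ S.card := by gcongr
        _ = ((2 * (p : ℝ) ^ 2 + 1) * (1 / (p : ℝ) ^ 6)) ^ S.card := by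
            rw [← mul_pow]
            push_cast
            rfl
        _ ≤ (1 / (p : ℝ) ^ 3) ^ S.card := by
            refine pow_le_pow_left₀ (by positivity) ?_ _
            rw [mul_one_div, div_le_div_iff₀ (by positivity) (by positivity), one_mul]
            calc (2 * (p : ℝ) ^ 2 + 1) * (p : ℝ) ^ 3 ≤ (p : ℝ) ^ 3 * (p : ℝ) ^ 3 := by
                  gcongr
                  nlinarith
              _ = _ := by ring
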